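/- Let X, Y, Z be Banach spaces, F : X ⇉ Y and G : X × Y ⇉ Z with ȳ ∈ F(x̄), z̄ ∈ G(x̄,ȳ), graphs locally closed, and Φ(x) := G(x, F(x)). Assume G is Lipschitz-like with respect to x uniformly in y around ((x̄,ȳ),z̄) with constant D ≥ 0, G is open at linear rate C > 0 with respect to y uniformly in x around ((x̄,ȳ),z̄), F is open at linear rate L > 0 around (x̄,ȳ), and LC − D > 0. Then there exists ε > 0 such that for every ρ ∈ (0,ε) and every (x,y,z) ∈ B(x̄,ε) × B(ȳ,ε) × B(z̄,ε) with y ∈ F(x) and z ∈ G(x,y), B(z, (LC−D)ρ) ⊆ Φ(B(x,ρ)). -/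

import Mathlib

open Set Metric Pointwise

open Filter Topology

/-- Geometric iteration: if from every point of `P` near the starting point `p₀` one can move to
another point of `P` whose last component is closer to `w` by the factor `q < 1`, at a cost
proportional to the current distance to `w`, then `P` contains a sequence whose last component
tends to `w` and whose other components converge, at controlled distance from those of `p₀`. -/
theorem exists_seq_tendsto_of_contracting_step
    {X Y Z : Type*} [MetricSpace X] [CompleteSpace X] [MetricSpace Y] [CompleteSpace Y]
    [MetricSpace Z] {P : Set (X × Y × Z)} {p₀ : X × Y × Z} (hp₀ : p₀ ∈ P) (w : Z)
    {a b q : ℝ} (ha : 0 ≤ a) (hb : 0 ≤ b) (hq₀ : 0 ≤ q) (hq₁ : q < 1)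
    (step : ∀ p ∈ P, dist p₀.1 p.1 ≤ a * dist p₀.2.2 w / (1 - q) →
      dist p₀.2.1 p.2.1 ≤ b * dist p₀.2.2 w / (1 - q) → dist p.2.2 w ≤ dist p₀.2.2 w →
      ∃ p' ∈ P, dist p.1 p'.1 ≤ a * dist p.2.2 w ∧ dist p.2.1 p'.2.1 ≤ b * dist p.2.2 w ∧
        dist p'.2.2 w ≤ q * dist p.2.2 w) :
    ∃ (u : ℕ → X × Y × Z) (x : X) (y : Y), (∀ n, u n ∈ P) ∧ Tendsto u atTop (𝓝 (x, y, w)) ∧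
      dist p₀.1 x ≤ a * dist p₀.2.2 w / (1 - q) ∧
      dist p₀.2.1 y ≤ b * dist p₀.2.2 w / (1 - q) := by
  have hq : 0 < 1 - q := sub_pos.2 hq₁
  set R := dist p₀.2.2 w
  have hR : 0 ≤ R := dist_nonneg
  have telescoping : ∀ {c d d' r r' : ℝ}, 0 ≤ c → d ≤ c * (R - r) / (1 - q) → d' ≤ c * r →
      r' ≤ q * r → d + d' ≤ c * (R - r') / (1 - q) := by
    intro c d d' r r' hc hd hd' hr'
    rw [le_div_iff₀ hq] at hd ⊢
    nlinarith [mul_le_mul_of_nonneg_right hd' hq.le, mul_le_mul_of_nonneg_left hr' hc]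
  have bound_le : ∀ {c d r : ℝ}, 0 ≤ c → 0 ≤ r → d ≤ c * (R - r) / (1 - q) →
      d ≤ c * R / (1 - q) := by
    intro c d r hc hr hd
    refine hd.trans ?_
    gcongr
    linarith
  let S := {p : X × Y × Z // p ∈ P ∧ dist p₀.1 p.1 ≤ a * (R - dist p.2.2 w) / (1 - q) ∧
    dist p₀.2.1 p.2.1 ≤ b * (R - dist p.2.2 w) / (1 - q) ∧ dist p.2.2 w ≤ R}
  have next : ∀ p : S, ∃ p' : S, dist p.1.1 p'.1.1 ≤ a * dist p.1.2.2 w ∧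
      dist p.1.2.1 p'.1.2.1 ≤ b * dist p.1.2.2 w ∧ dist p'.1.2.2 w ≤ q * dist p.1.2.2 w := by
    rintro ⟨p, hp, hx, hy, hz⟩
    obtain ⟨p', hp', hx', hy', hz'⟩ := step p hp (bound_le ha dist_nonneg hx)
      (bound_le hb dist_nonneg hy) hz
    have hz'' : q * dist p.2.2 w ≤ dist p.2.2 w := mul_le_of_le_one_left dist_nonneg hq₁.le
    exact ⟨⟨p', hp', (dist_triangle _ _ _).trans (telescoping ha hx hx' hz'),
      (dist_triangle _ _ _).trans (telescoping hb hy hy' hz'), by linarith⟩, hx', hy', hz'⟩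
  choose f hfx hfy hfz using next
  let s₀ : S := ⟨p₀, hp₀, by simp [R], by simp [R], le_rfl⟩
  let u : ℕ → S := fun n => f^[n] s₀
  have hu : ∀ n, u (n + 1) = f (u n) := fun n => Function.iterate_succ_apply' f n s₀
  have hres : ∀ n, dist (u n).1.2.2 w ≤ R * q ^ n := by
    intro n
    induction n with
    | zero => simp [u, s₀, R]
    | succ n ih =>
      rw [hu]
      calc _ ≤ q * dist (u n).1.2.2 w := hfz _
        _ ≤ q * (R * q ^ n) := by gcongr
        _ = R * q ^ (n + 1) := by ring
  have hdx : ∀ n, dist (u n).1.1 (u (n + 1)).1.1 ≤ a * R * q ^ n := by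
    intro n
    rw [hu, mul_assoc]
    exact (hfx _).trans (mul_le_mul_of_nonneg_left (hres n) ha)
  have hdy : ∀ n, dist (u n).1.2.1 (u (n + 1)).1.2.1 ≤ b * R * q ^ n := by
    intro n
    rw [hu, mul_assoc]
    exact (hfy _).trans (mul_le_mul_of_nonneg_left (hres n) hb)
  obtain ⟨x, hx⟩ := cauchySeq_tendsto_of_complete (cauchySeq_of_le_geometric q (a * R) hq₁ hdx)
  obtain ⟨y, hy⟩ := cauchySeq_tendsto_of_complete (cauchySeq_of_le_geometric q (b * R) hq₁ hdy)
  have hw : Tendsto (fun n => (u n).1.2.2) atTop (𝓝 w) := by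
    rw [tendsto_iff_dist_tendsto_zero]
    refine squeeze_zero (fun _ => dist_nonneg) hres ?_
    simpa using (tendsto_pow_atTop_nhds_zero_of_lt_one hq₀ hq₁).const_mul R
  exact ⟨fun n => (u n).1, x, y, fun n => (u n).2.1, hx.prodMk_nhds (hy.prodMk_nhds hw),
    dist_le_of_le_geometric_of_tendsto₀ q (a * R) hq₁ hdx hx,
    dist_le_of_le_geometric_of_tendsto₀ q (b * R) hq₁ hdy hy⟩

/-- A limit of points of a set which is closed near `c` belongs to the set, if it is near `c`. -/
theorem mem_of_tendsto_of_isClosed_inter_closedBall {E : Type*} [PseudoMetricSpace E]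
    {S : Set E} {c e : E} {r : ℝ} (hS : IsClosed (S ∩ closedBall c r)) (he : e ∈ ball c r)
    {u : ℕ → E} (hu : ∀ n, u n ∈ S) (hlim : Tendsto u atTop (𝓝 e)) : e ∈ S := by
  refine (hS.mem_of_tendsto hlim ?_).1
  filter_upwards [hlim.eventually (isOpen_ball.mem_nhds he)] with n hn
  exact ⟨hu n, ball_subset_closedBall hn⟩

/-- Openness at linear rate `L*C − D` of `Φ(x) := G(x, F(x))` at points with
intermediate points near the reference point (part (A) of the theorem). -/
theorem openness_of_composition_A
    {X Y Z : Type*} [NormedAddCommGroup X] [NormedSpace ℝ X] [CompleteSpace X]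
    [NormedAddCommGroup Y] [NormedSpace ℝ Y] [CompleteSpace Y]
    [NormedAddCommGroup Z] [NormedSpace ℝ Z] [CompleteSpace Z]
    (F : X → Set Y) (G : X → Y → Set Z)
    (x₀ : X) (y₀ : Y) (z₀ : Z) (hy : y₀ ∈ F x₀) (hz : z₀ ∈ G x₀ y₀)
    (L C D : ℝ) (hL : 0 < L) (hC : 0 < C) (hD : 0 ≤ D)
    (hclF : ∃ r > 0, IsClosed ({q : X × Y | q.2 ∈ F q.1} ∩ Metric.closedBall (x₀, y₀) r))
    (hclG : ∃ r > 0, IsClosed ({q : (X × Y) × Z | q.2 ∈ G q.1.1 q.1.2} ∩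
      Metric.closedBall ((x₀, y₀), z₀) r))
    -- (i) G is D-Lipschitz-like w.r.t. x uniformly in y around ((x₀,y₀),z₀)
    (hGl : ∃ U ∈ nhds x₀, ∃ V ∈ nhds y₀, ∃ V' ∈ nhds z₀,
      ∀ y ∈ V, ∀ x ∈ U, ∀ x' ∈ U,
        G x y ∩ V' ⊆ G x' y + (D * ‖x - x'‖) • Metric.closedBall (0:Z) 1)
    -- (ii) G is C-open w.r.t. y uniformly in x around ((x₀,y₀),z₀)
    (hGo : ∃ ε > 0, ∃ U ∈ nhds x₀, ∃ V ∈ nhds y₀, ∃ V' ∈ nhds z₀,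
      ∀ ρ ∈ Ioo (0:ℝ) ε, ∀ x ∈ U, ∀ y ∈ V, ∀ z ∈ V', z ∈ G x y →
        ball z (ρ * C) ⊆ ⋃ y' ∈ ball y ρ, G x y')
    -- (iii) F is L-open around (x₀,y₀)
    (hF : ∃ ε > 0, ∃ U ∈ nhds x₀, ∃ V ∈ nhds y₀,
      ∀ ρ ∈ Ioo (0:ℝ) ε, ∀ x ∈ U, ∀ y ∈ V, y ∈ F x →
        ball y (ρ * L) ⊆ ⋃ x' ∈ ball x ρ, F x')
    -- (iv)
    (hrate : 0 < L * C - D) :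
    ∃ ε > 0, ∀ ρ ∈ Ioo (0:ℝ) ε,
      ∀ x ∈ ball x₀ ε, ∀ y ∈ ball y₀ ε, ∀ z ∈ ball z₀ ε,
        y ∈ F x → z ∈ G x y →
          ball z ((L * C - D) * ρ) ⊆ ⋃ x' ∈ ball x ρ, ⋃ y' ∈ F x', G x' y' := by
  obtain ⟨rF, hrF, hclF⟩ := hclF
  obtain ⟨rG, hrG, hclG⟩ := hclG
  obtain ⟨Ul, hUl, Vl, hVl, Wl, hWl, hGl⟩ := hGl
  obtain ⟨εG, hεG, Uo, hUo, Vo, hVo, Wo, hWo, hGo⟩ := hGo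
  obtain ⟨εF, hεF, UF, hUF, VF, hVF, hF⟩ := hF
  obtain ⟨δx, hδx, hU⟩ := Metric.mem_nhds_iff.1 (inter_mem hUl (inter_mem hUo hUF))
  obtain ⟨δy, hδy, hV⟩ := Metric.mem_nhds_iff.1 (inter_mem hVl (inter_mem hVo hVF))
  obtain ⟨δz, hδz, hW⟩ := Metric.mem_nhds_iff.1 (inter_mem hWl hWo)
  obtain ⟨δ, hδ, hδle⟩ : ∃ δ > 0, δ ≤ δx ∧ δ ≤ δy ∧ δ ≤ δz ∧ δ ≤ rF ∧ δ ≤ rG ∧ δ ≤ εF ∧ δ ≤ εG :=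
    ⟨min δx (min δy (min δz (min rF (min rG (min εF εG))))), by positivity, by simp⟩
  obtain ⟨hx_le, hy_le, hz_le, hrF_le, hrG_le, hεF_le, hεG_le⟩ := hδle
  have hLC : 0 < L * C := mul_pos hL hC
  have hM : 0 < 3 + 2 * L + 2 * (L * C) := by positivity
  refine ⟨δ / (3 + 2 * L + 2 * (L * C)), by positivity, ?_⟩
  set ε := δ / (3 + 2 * L + 2 * (L * C))
  have hε : 0 < ε := by positivity
  have hεM : ε * 3 + 2 * (L * ε) + 2 * (L * C * ε) = δ := by
    have : ε * (3 + 2 * L + 2 * (L * C)) = δ := div_mul_cancel₀ _ hM.ne'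
    linarith
  have hLε : 0 < L * ε := mul_pos hL hε
  have hLCε : 0 < L * C * ε := mul_pos hLC hε
  rintro ρ ⟨hρ, hρε⟩ x hx y hy z hz hyx hzxy w hw
  rw [mem_ball] at hx hy hz
  rw [mem_ball'] at hw
  have hLρ : L * ρ < L * ε := mul_lt_mul_of_pos_left hρε hL
  have hLCρ : L * C * ρ < L * C * ε := mul_lt_mul_of_pos_left hρε hLC
  have hDρ : 0 ≤ D * ρ := by positivity
  have hwδ : dist z w < L * C * ε := by linarith
  have hw₀ : dist w z₀ < ε + L * C * ε := by
    linarith [dist_triangle_left w z₀ z]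
  obtain ⟨κ, hκ₁, hκ₂⟩ : ∃ κ, D + dist z w / ρ < κ ∧ κ < L * C := by
    refine exists_between ?_
    have : dist z w / ρ < L * C - D := (div_lt_iff₀ hρ).2 hw
    linarith
  have hDκ : D < κ := by
    have : 0 ≤ dist z w / ρ := by positivity
    linarith
  have hκ : 0 < κ := hD.trans_lt hDκ
  have hR : dist z w / (κ - D) < ρ := by
    rw [div_lt_comm₀ (sub_pos.2 hDκ) hρ]
    linarith
  have hax : κ⁻¹ * dist z w / (1 - D / κ) < ρ := by
    convert hR using 1
    field_simp [(sub_pos.2 hDκ).ne']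
  have hay : L * κ⁻¹ * dist z w / (1 - D / κ) < L * ρ := by
    rw [mul_assoc, mul_div_assoc]
    exact mul_lt_mul_of_pos_left hax hL
  have hRκ : dist z w / κ < ρ :=
    (div_le_div_of_nonneg_left dist_nonneg (sub_pos.2 hDκ) (by linarith)).trans_lt hR
  obtain ⟨u, x', y', hu, hlim, hxx', hyy'⟩ := exists_seq_tendsto_of_contracting_step
    (P := {p : X × Y × Z | p.2.1 ∈ F p.1 ∧ p.2.2 ∈ G p.1 p.2.1}) (p₀ := (x, y, z))
    ⟨hyx, hzxy⟩ w (a := κ⁻¹) (b := L * κ⁻¹) (q := D / κ)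
    (by positivity) (by positivity) (by positivity) ((div_lt_one hκ).2 hDκ) (by
      rintro ⟨x₁, y₁, z₁⟩ ⟨hyx₁, hzxy₁⟩ hx₁ hy₁ hz₁
      dsimp only at hyx₁ hzxy₁ hx₁ hy₁ hz₁ ⊢
      rcases (dist_nonneg (x := z₁) (y := w)).eq_or_lt with h₀ | hpos
      · exact ⟨(x₁, y₁, z₁), ⟨hyx₁, hzxy₁⟩, by simp [← h₀], by simp [← h₀], by simp [← h₀]⟩
      set s := κ⁻¹ * dist z₁ w with hs_def
      have hs : 0 < s := by positivity
      have hsρ : s < ρ := by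
        refine lt_of_le_of_lt ?_ hRκ
        rw [hs_def, inv_mul_eq_div]
        gcongr
      have hLs : L * s < L * ρ := mul_lt_mul_of_pos_left hsρ hL
      have hκs : κ * s = dist z₁ w := mul_inv_cancel_left₀ hκ.ne' _
      have hx₁₀ : dist x₁ x₀ < 2 * ε := by linarith [dist_triangle_left x₁ x₀ x]
      have hy₁₀ : dist y₁ y₀ < ε + L * ε := by linarith [dist_triangle_left y₁ y₀ y]
      have hz₁₀ : dist z₁ z₀ < ε + 2 * (L * C * ε) := by linarith [dist_triangle z₁ w z₀]
      have hU₁ := hU (show x₁ ∈ ball x₀ δx from by rw [mem_ball]; linarith)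
      have hV₁ := hV (show y₁ ∈ ball y₀ δy from by rw [mem_ball]; linarith)
      have hW₁ := hW (show z₁ ∈ ball z₀ δz from by rw [mem_ball]; linarith)
      have hw_mem : w ∈ ball z₁ (L * s * C) := by
        rw [mem_ball', ← hκs]
        nlinarith [mul_lt_mul_of_pos_right hκ₂ hs]
      have hwG := hGo (L * s) ⟨by positivity, by linarith⟩ x₁ hU₁.2.1 y₁ hV₁.2.1 z₁ hW₁.2
        hzxy₁ hw_mem
      simp only [mem_iUnion, exists_prop] at hwG
      obtain ⟨y₂, hy₂, hwG⟩ := hwG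
      have hyF := hF s ⟨hs, by linarith⟩ x₁ hU₁.2.2 y₁ hV₁.2.2 hyx₁
        (show y₂ ∈ ball y₁ (s * L) by rwa [mul_comm])
      simp only [mem_iUnion, exists_prop] at hyF
      obtain ⟨x₂, hx₂, hyF⟩ := hyF
      rw [mem_ball] at hy₂ hx₂
      have hU₂ := hU (show x₂ ∈ ball x₀ δx by
        rw [mem_ball]; linarith [dist_triangle x₂ x₁ x₀])
      have hV₂ := hV (show y₂ ∈ ball y₀ δy by
        rw [mem_ball]; linarith [dist_triangle y₂ y₁ y₀])
      have hW₂ := hW (show w ∈ ball z₀ δz by rw [mem_ball]; linarith)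
      obtain ⟨z₂, hz₂, e, ⟨v, hv, rfl⟩, hsum⟩ := hGl y₂ hV₂.1 x₁ hU₁.1 x₂ hU₂.1 ⟨hwG, hW₂.1⟩
      refine ⟨(x₂, y₂, z₂), ⟨hyF, hz₂⟩, by rw [dist_comm]; exact hx₂.le, ?_, ?_⟩
      · rw [dist_comm, mul_assoc]; exact hy₂.le
      · dsimp only at hsum ⊢
        rw [← dist_eq_norm] at hsum
        rw [mem_closedBall_zero_iff] at hv
        rw [← hsum, dist_self_add_right, norm_smul, Real.norm_of_nonneg (by positivity), hsum]
        calc D * dist x₁ x₂ * ‖v‖ ≤ D * dist x₁ x₂ * 1 := by gcongr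
          _ ≤ D * s := by rw [mul_one, dist_comm]; gcongr
          _ = D / κ * dist z₁ w := by rw [hs_def]; ring)
  dsimp only at hxx' hyy'
  have hx'₀ : dist x' x₀ < 2 * ε := by linarith [dist_triangle_left x' x₀ x]
  have hy'₀ : dist y' y₀ < ε + L * ε := by linarith [dist_triangle_left y' y₀ y]
  have hlimxy : Tendsto (fun n => ((u n).1, (u n).2.1)) atTop (𝓝 (x', y')) :=
    hlim.fst_nhds.prodMk_nhds hlim.snd_nhds.fst_nhds
  have hyF : y' ∈ F x' :=
    mem_of_tendsto_of_isClosed_inter_closedBall (S := {q : X × Y | q.2 ∈ F q.1}) hclF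
      (show (x', y') ∈ ball (x₀, y₀) rF by
        rw [mem_ball, Prod.dist_eq, max_lt_iff]; constructor <;> dsimp only <;> linarith)
      (fun n => (hu n).1) hlimxy
  have hwG : w ∈ G x' y' :=
    mem_of_tendsto_of_isClosed_inter_closedBall
      (S := {q : (X × Y) × Z | q.2 ∈ G q.1.1 q.1.2}) hclG
      (show ((x', y'), w) ∈ ball ((x₀, y₀), z₀) rG by
        rw [mem_ball, Prod.dist_eq, Prod.dist_eq, max_lt_iff, max_lt_iff]
        refine ⟨⟨?_, ?_⟩, ?_⟩ <;> dsimp only <;> linarith)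
      (fun n => (hu n).2) (hlimxy.prodMk_nhds hlim.snd_nhds.snd_nhds)
  simp only [mem_iUnion, exists_prop]
  exact ⟨x', mem_ball'.2 (hxx'.trans_lt hax), y', hyF, hwG⟩
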